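/- arXiv:2505.04953 — 8 statements merged into one kernel-verified Lean document; each statement's English description precedes it below -/
import Mathlib

section
/- Let α be a linear order and let x, v, w be lists over α. If lcpLen x w > lcpLen v w, then lcpLen v x = lcpLen v w; moreover, v < x in the lexicographic order if and only if v < w, and x < v if and only if w < v. (Hence the outcome of comparing x with v, and the LCP length lcpLen v x, are determined without inspecting any characters whenever x shares a strictly longer prefix with the reference key w than v does.) -/
open Classical in
/-- Length of the longest common prefix of two lists. -/
noncomputable def lcpLen {α : Type*} : List α → List α → ℕ
  | a :: x, b :: y => if a = b then lcpLen x y + 1 else 0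
  | _, _ => 0

/-- The character-free case of the `k-Compare` bookend comparison procedure:
if `x` shares a strictly longer prefix with the reference key `w` than `v` does,
then `lcpLen v x = lcpLen v w`, and the lexicographic comparison of `x` with `v`
has the same outcome as that of `w` with `v`. -/
theorem kCompare_longer_prefix {α : Type*} [LinearOrder α] (x v w : List α)
    (h : lcpLen v w < lcpLen x w) :
    lcpLen v x = lcpLen v w ∧
      (List.Lex (· < ·) v x ↔ List.Lex (· < ·) v w) ∧
      (List.Lex (· < ·) x v ↔ List.Lex (· < ·) w v) := by
  induction w generalizing x v with
  | nil => cases x <;> simp [lcpLen] at h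
  | cons c w ih =>
    cases x with
    | nil => simp [lcpLen] at h
    | cons a x =>
      by_cases hac : a = c
      · subst hac
        cases v with
        | nil => simp [lcpLen]
        | cons b v =>
          by_cases hba : b = a
          · subst hba
            simp only [lcpLen, if_true] at h
            obtain ⟨h1, h2, h3⟩ := ih x v (by omega)
            refine ⟨by simp [lcpLen, h1], ?_, ?_⟩
            · simpa [List.lex_cons_iff] using h2
            · simpa [List.lex_cons_iff] using h3
          · refine ⟨by simp [lcpLen, hba], ?_, ?_⟩
            · constructor <;> intro h' <;> cases h' <;>
                first | exact List.Lex.rel ‹_› | exact absurd rfl hba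
            · constructor <;> intro h' <;> cases h' <;>
                first | exact List.Lex.rel ‹_› | exact absurd rfl hba
      · simp [lcpLen, hac] at h
end

section
/- Let α be a linear order and let x, v, w be lists over α. If v < w in the lexicographic order and lcpLen x w > lcpLen v w, then v < x and lcpLen v x = lcpLen v w. -/
/-- Case (a) of the `k-Compare` procedure: if `v` precedes the successor bookend `w`
lexicographically and `x` shares a strictly longer prefix with `w` than `v` does,
then `v` precedes `x` and `lcpLen v x = lcpLen v w`. -/
theorem kCompare_case_a {α : Type*} [LinearOrder α] (x v w : List α)
    (hvw : List.Lex (· < ·) v w) (h : lcpLen v w < lcpLen x w) :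
    List.Lex (· < ·) v x ∧ lcpLen v x = lcpLen v w := by
  induction hvw generalizing x with
  | nil =>
    cases x with
    | nil => simp [lcpLen] at h
    | cons c x => exact ⟨List.Lex.nil, by simp [lcpLen]⟩
  | @cons a as bs hab ih =>
    cases x with
    | nil => simp [lcpLen] at h
    | cons c x =>
      by_cases hc : c = a
      · subst hc
        simp only [lcpLen, if_true] at h ⊢
        obtain ⟨h1, h2⟩ := ih x (by omega)
        exact ⟨List.Lex.cons h1, by omega⟩
      · simp [lcpLen, hc] at h
  | @rel a as b bs hab =>
    cases x with
    | nil => simp [lcpLen] at h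
    | cons c x =>
      by_cases hc : c = b
      · subst hc
        exact ⟨List.Lex.rel hab, by simp [lcpLen, hab.ne]⟩
      · simp [lcpLen, hc] at h
end

section
/- Let α be a linear order and let x, v, w be lists over α. If x < w in the lexicographic order and lcpLen x w < lcpLen v w, then x < v and lcpLen x v = lcpLen x w. -/
/-- Case (b) of the `k-Compare` procedure: if `x` precedes the successor bookend `w`
lexicographically and `x` shares a strictly shorter prefix with `w` than `v` does,
then `x` precedes `v` and `lcpLen x v = lcpLen x w`. -/
theorem kCompare_case_b {α : Type*} [LinearOrder α] (x v w : List α)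
    (hxw : List.Lex (· < ·) x w) (h : lcpLen x w < lcpLen v w) :
    List.Lex (· < ·) x v ∧ lcpLen x v = lcpLen x w := by
  induction hxw generalizing v with
  | nil =>
    cases v with
    | nil => simp [lcpLen] at h
    | cons c v => exact ⟨List.Lex.nil, by simp [lcpLen]⟩
  | @cons a x y hxy ih =>
    cases v with
    | nil => simp [lcpLen] at h
    | cons c v =>
      by_cases hc : c = a
      · subst hc
        simp only [lcpLen, if_true] at h ⊢
        obtain ⟨h1, h2⟩ := ih v (by omega)
        exact ⟨List.Lex.cons h1, by omega⟩
      · simp [lcpLen, hc] at h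
  | @rel a x b y hab =>
    cases v with
    | nil => simp [lcpLen] at h
    | cons c v =>
      by_cases hc : c = b
      · subst hc
        exact ⟨List.Lex.rel hab, by simp [lcpLen, ne_of_lt hab]⟩
      · simp [lcpLen, hc] at h
end

section
/- Let α be a type with decidable equality and let x, v, w be lists over α. If lcpLen x w = lcpLen v w = t, then x.take t = v.take t, and consequently lcpLen x v = t + lcpLen (x.drop t) (v.drop t). More generally, for any t ≤ lcpLen x v one has lcpLen x v = t + lcpLen (x.drop t) (v.drop t). -/
theorem lcpLen_take {α : Type*} (x y : List α) :
    x.take (lcpLen x y) = y.take (lcpLen x y) := by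
  induction x generalizing y with
  | nil => cases y <;> simp [lcpLen]
  | cons a x ih =>
    cases y with
    | nil => simp [lcpLen]
    | cons b y =>
      by_cases h : a = b
      · simp [lcpLen, h, ih]
      · simp [lcpLen, h]

theorem lcpLen_offset {α : Type*} (x y : List α) (t : ℕ) (ht : t ≤ lcpLen x y) :
    lcpLen x y = t + lcpLen (x.drop t) (y.drop t) := by
  induction t generalizing x y with
  | zero => simp
  | succ t ih =>
    cases x with
    | nil => simp [lcpLen] at ht
    | cons a x =>
      cases y with
      | nil => simp [lcpLen] at ht
      | cons b y =>
        by_cases h : a = b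
        · simp only [lcpLen, h, if_true, List.drop_succ_cons] at ht ⊢
          have := ih x y (by omega)
          omega
        · simp [lcpLen, h] at ht

theorem lcpLen_min_le {α : Type*} (x v w : List α) (t : ℕ)
    (hx : t ≤ lcpLen x w) (hv : t ≤ lcpLen v w) : t ≤ lcpLen x v := by
  induction t generalizing x v w with
  | zero => simp
  | succ t ih =>
    cases w with
    | nil => cases x <;> simp [lcpLen] at hx
    | cons c w =>
      cases x with
      | nil => simp [lcpLen] at hx
      | cons a x =>
        cases v with
        | nil => simp [lcpLen] at hv
        | cons b v =>
          by_cases h : a = c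
          · by_cases h' : b = c
            · simp only [lcpLen, h, h', if_true] at hx hv ⊢
              have := ih x v w (by omega) (by omega)
              omega
            · simp [lcpLen, h'] at hv
          · simp [lcpLen, h] at hx

/-- Case (c) of the `k-Compare` procedure: if the search key `x` and the node key `v`
share the same LCP length `t` with the bookend `w`, then `x.take t = v.take t` and the
LCP computation between `x` and `v` may correctly start at offset `t`.  More generally,
the LCP computation may start at any offset `t' ≤ lcpLen x v`. -/
theorem kCompare_case_c {α : Type*} [DecidableEq α] (x v w : List α) (t : ℕ)
    (hxw : lcpLen x w = t) (hvw : lcpLen v w = t) :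
    x.take t = v.take t ∧
      lcpLen x v = t + lcpLen (x.drop t) (v.drop t) ∧
      (∀ t' ≤ lcpLen x v, lcpLen x v = t' + lcpLen (x.drop t') (v.drop t')) := by
  refine ⟨?_, ?_, fun t' ht' => lcpLen_offset x v t' ht'⟩
  · have h1 := lcpLen_take x w
    have h2 := lcpLen_take v w
    rw [hxw] at h1
    rw [hvw] at h2
    rw [h1, h2]
  · exact lcpLen_offset x v t (lcpLen_min_le x v w t hxw.ge hvw.ge)
end

section
/- Let α be a linear order and let s, p, x be lists over α with s ≤ p ≤ x in the lexicographic order. Then lcpLen s x ≤ lcpLen p x. Symmetrically, if x ≤ q ≤ s then lcpLen x s ≤ lcpLen x q. -/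
theorem lex_cons_aux {α : Type*} [LinearOrder α] {a b : α} {s p : List α}
    (h : List.Lex (· < ·) (a :: s) (b :: p) ∨ a :: s = b :: p) :
    a < b ∨ (a = b ∧ (List.Lex (· < ·) s p ∨ s = p)) := by
  rcases h with h | h
  · cases h with
    | rel h => exact Or.inl h
    | cons h => exact Or.inr ⟨rfl, Or.inl h⟩
  · injection h with h1 h2
    exact Or.inr ⟨h1, Or.inr h2⟩

theorem lex_nil_aux {α : Type*} [LinearOrder α] {a : α} {s : List α}
    (h : List.Lex (· < ·) (a :: s) [] ∨ a :: s = []) : False := by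
  rcases h with h | h <;> cases h

/-- Monotonicity of LCP length along the lexicographic order: if `s ≤ p ≤ x`
then `lcpLen s x ≤ lcpLen p x`; symmetrically, if `x ≤ q ≤ s` then
`lcpLen x s ≤ lcpLen x q`. -/
theorem lcpLen_mono_of_between {α : Type*} [LinearOrder α] :
    (∀ s p x : List α,
      (List.Lex (· < ·) s p ∨ s = p) → (List.Lex (· < ·) p x ∨ p = x) →
        lcpLen s x ≤ lcpLen p x) ∧
    (∀ x q s : List α,
      (List.Lex (· < ·) x q ∨ x = q) → (List.Lex (· < ·) q s ∨ q = s) →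
        lcpLen x s ≤ lcpLen x q) := by
  constructor
  · intro s
    induction s with
    | nil => intro p x _ _; simp [lcpLen]
    | cons a s ih =>
      intro p x h1 h2
      cases p with
      | nil => exact (lex_nil_aux h1).elim
      | cons b p =>
        cases x with
        | nil => exact (lex_nil_aux h2).elim
        | cons c x =>
          by_cases hac : a = c
          · subst hac
            rcases lex_cons_aux h1 with h1 | ⟨rfl, h3⟩
            · rcases lex_cons_aux h2 with h2 | ⟨rfl, h2⟩
              · exact (lt_asymm h1 h2).elim
              · exact (lt_irrefl _ h1).elim
            · rcases lex_cons_aux h2 with h2 | ⟨_, h2⟩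
              · exact (lt_irrefl _ h2).elim
              · simpa [lcpLen] using ih p x h3 h2
          · simp [lcpLen, hac]
  · intro x
    induction x with
    | nil => intro q s _ _; simp [lcpLen]
    | cons a x ih =>
      intro q s h1 h2
      cases q with
      | nil => exact (lex_nil_aux h1).elim
      | cons b q =>
        cases s with
        | nil => exact (lex_nil_aux h2).elim
        | cons c s =>
          by_cases hac : a = c
          · subst hac
            rcases lex_cons_aux h1 with h1 | ⟨rfl, h3⟩
            · rcases lex_cons_aux h2 with h2 | ⟨rfl, h2⟩
              · exact (lt_asymm h1 h2).elim
              · exact (lt_irrefl _ h1).elim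
            · rcases lex_cons_aux h2 with h2 | ⟨_, h2⟩
              · exact (lt_irrefl _ h2).elim
              · simpa [lcpLen] using ih q s h3 h2
          · simp [lcpLen, hac]
end

section
/- Let α be a linear order, S a finite set of lists over α, and x a list with x ∉ S. Suppose both P := {s ∈ S | s < x} and Q := {s ∈ S | x < s} (lexicographic order) are nonempty, and let p be the maximum of P and q the minimum of Q. Then for every s ∈ S, lcpLen x s ≤ max (lcpLen x p) (lcpLen x q); that is, x attains its longest common prefix over S with its lexical predecessor p or its lexical successor q. -/
theorem lcpLen_mono_below {α : Type*} [LinearOrder α] (x : List α) : ∀ s p : List α,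
    List.Lex (· < ·) s p → List.Lex (· < ·) p x → lcpLen x s ≤ lcpLen x p := by
  induction x with
  | nil => intro s p _ h; cases h
  | cons a x ih =>
    intro s p h1 h2
    cases h1 with
    | nil => simp [lcpLen]
    | cons h =>
      cases h2 with
      | cons h' => simpa [lcpLen] using ih _ _ h h'
      | rel h' => simp [lcpLen, h'.ne']
    | rel h =>
      cases h2 with
      | cons h' => simp [lcpLen, h.ne']
      | rel h' => simp [lcpLen, (h.trans h').ne']

theorem lcpLen_mono_above {α : Type*} [LinearOrder α] (x : List α) : ∀ s q : List α,
    List.Lex (· < ·) q s → List.Lex (· < ·) x q → lcpLen x s ≤ lcpLen x q := by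
  induction x with
  | nil => intro s p _ h; simp [lcpLen]
  | cons a x ih =>
    intro s p h1 h2
    cases h1 with
    | nil => cases h2
    | cons h =>
      cases h2 with
      | cons h' => simpa [lcpLen] using ih _ _ h h'
      | rel h' => simp [lcpLen, h'.ne]
    | rel h =>
      cases h2 with
      | cons h' => simp [lcpLen, h.ne]
      | rel h' => simp [lcpLen, (h'.trans h).ne]

open scoped Classical in
/-- A key `x` not in a finite set `S` of strings attains its longest common prefix
over `S` with its lexical predecessor `p` (the maximum of `P = {s ∈ S | s < x}`) or
its lexical successor `q` (the minimum of `Q = {s ∈ S | x < s}`). -/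
theorem lcpLen_le_max_bookends {α : Type*} [LinearOrder α]
    (S : Finset (List α)) (x : List α) (hx : x ∉ S)
    (hP : (S.filter fun s => List.Lex (· < ·) s x).Nonempty)
    (hQ : (S.filter fun s => List.Lex (· < ·) x s).Nonempty) :
    ∀ s ∈ S,
      lcpLen x s ≤
        max (lcpLen x ((S.filter fun s => List.Lex (· < ·) s x).max' hP))
            (lcpLen x ((S.filter fun s => List.Lex (· < ·) x s).min' hQ)) := by
  intro s hs
  rcases lt_trichotomy s x with h | h | h
  · have hm : s ∈ S.filter fun s => List.Lex (· < ·) s x := Finset.mem_filter.2 ⟨hs, h⟩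
    have hp := (Finset.mem_filter.1 (Finset.max'_mem _ hP)).2
    refine le_max_of_le_left ?_
    rcases (Finset.le_max' _ s hm).lt_or_eq with h' | h'
    · exact lcpLen_mono_below x _ _ h' hp
    · exact (congrArg (lcpLen x) h').le
  · exact absurd (h ▸ hs) hx
  · have hm : s ∈ S.filter fun s => List.Lex (· < ·) x s := Finset.mem_filter.2 ⟨hs, h⟩
    have hq := (Finset.mem_filter.1 (Finset.min'_mem _ hQ)).2
    refine le_max_of_le_right ?_
    rcases (Finset.min'_le _ s hm).lt_or_eq with h' | h'
    · exact lcpLen_mono_above x _ _ h' hq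
    · exact (congrArg (lcpLen x) h').ge
end

section
/- Let T be a binary search tree over a linear order α, let x be a key not occurring in T, and let T' be obtained from T by a zip-tree insertion of x: some subtree S of T whose root lies on the search path of x in T is replaced by node P x Q, where (P, Q) = unzip S x. Then for every key w of T that is not among the keys of the search path of x within S (the 'unzipping path'), the set of ancestor keys of w smaller than w has the same maximum in T and T', and the set of ancestor keys of w greater than w has the same minimum in T and T' (each existing in T' if and only if it exists in T). That is, w's immediate predecessor ancestor π_w⁻ and immediate successor ancestor π_w⁺ are unchanged by the insertion. -/
/-- Binary trees with keys at the nodes. -/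
inductive BTree (α : Type*) where
  | leaf : BTree α
  | node : BTree α → α → BTree α → BTree α

namespace BTree

variable {α : Type*}

/-- The list of keys of a binary tree. -/
def keys : BTree α → List α
  | leaf => []
  | node l k r => keys l ++ k :: keys r

/-- Binary search tree property. -/
def IsBST [LT α] : BTree α → Prop
  | leaf => True
  | node l k r =>
      (∀ a ∈ keys l, a < k) ∧ (∀ a ∈ keys r, k < a) ∧ IsBST l ∧ IsBST r

variable [LinearOrder α]

/-- The sequence of keys visited by the standard BST search for `x`. -/
def searchPath (x : α) : BTree α → List α
  | leaf => []
  | node l k r =>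
      if x < k then k :: searchPath x l
      else if k < x then k :: searchPath x r
      else [k]

/-- The ancestor keys of a key `w`: the keys on the search path of `w`
other than `w` itself. -/
def ancestors (w : α) (t : BTree α) : List α :=
  (searchPath w t).filter fun a => a ≠ w

/-- The zip-tree `unzip` operation at a key `x`. -/
def unzip : BTree α → α → BTree α × BTree α
  | leaf, _ => (leaf, leaf)
  | node l k r, x =>
      if k < x then
        let PQ := unzip r x
        (node l k PQ.1, PQ.2)
      else
        let PQ := unzip l x
        (PQ.1, node PQ.2 k r)

/-- `ZipInsertAt x T S T'` : the subtree `S` of `T`, whose root lies on the search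
path of `x` in `T`, is replaced by `node P x Q` where `(P, Q) = unzip S x`,
producing `T'`.  This is precisely a zip-tree insertion of `x` into `T`. -/
inductive ZipInsertAt (x : α) : BTree α → BTree α → BTree α → Prop
  | here (S : BTree α) :
      ZipInsertAt x S S (node (unzip S x).1 x (unzip S x).2)
  | left {l S l' : BTree α} {k : α} (r : BTree α) :
      x < k → ZipInsertAt x l S l' → ZipInsertAt x (node l k r) S (node l' k r)
  | right (l : BTree α) {k : α} {r S r' : BTree α} :
      k < x → ZipInsertAt x r S r' → ZipInsertAt x (node l k r) S (node l k r')

end BTree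

namespace BTree

variable {α : Type*} [LinearOrder α]

/-- Immediate predecessor ancestor. -/
def lo (w : α) (t : BTree α) : WithBot α :=
  ((ancestors w t).filter fun a => a < w).maximum

/-- Immediate successor ancestor. -/
def hi (w : α) (t : BTree α) : WithTop α :=
  ((ancestors w t).filter fun a => w < a).minimum

theorem lo_left {w k : α} (l r : BTree α) (h : w < k) : lo w (node l k r) = lo w l := by
  simp [lo, ancestors, searchPath, h, h.ne', h.le, List.filter_cons]

theorem hi_left {w k : α} (l r : BTree α) (h : w < k) :
    hi w (node l k r) = min (k : WithTop α) (hi w l) := by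
  simp [hi, ancestors, searchPath, h, h.ne', List.filter_cons, List.minimum_cons]

theorem lo_right {w k : α} (l r : BTree α) (h : k < w) :
    lo w (node l k r) = max (k : WithBot α) (lo w r) := by
  simp [lo, ancestors, searchPath, h, h.ne, h.not_gt, List.filter_cons, List.maximum_cons]

theorem hi_right {w k : α} (l r : BTree α) (h : k < w) : hi w (node l k r) = hi w r := by
  simp [hi, ancestors, searchPath, h, h.ne, h.not_gt, h.le, List.filter_cons]

theorem lo_self (w : α) (l r : BTree α) : lo w (node l w r) = ⊥ := by
  simp [lo, ancestors, searchPath]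

theorem hi_self (w : α) (l r : BTree α) : hi w (node l w r) = ⊤ := by
  simp [hi, ancestors, searchPath]

theorem mem_left {w k : α} {l r : BTree α} (hb : (node l k r).IsBST)
    (hw : w ∈ (node l k r).keys) (h : w < k) : w ∈ l.keys := by
  simp only [keys, List.mem_append, List.mem_cons] at hw
  rcases hw with hw | hw | hw
  · exact hw
  · exact absurd hw h.ne
  · exact absurd (hb.2.1 w hw) h.not_gt

theorem mem_right {w k : α} {l r : BTree α} (hb : (node l k r).IsBST)
    (hw : w ∈ (node l k r).keys) (h : k < w) : w ∈ r.keys := by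
  simp only [keys, List.mem_append, List.mem_cons] at hw
  rcases hw with hw | hw | hw
  · exact absurd (hb.1 w hw) h.not_gt
  · exact absurd hw h.ne'
  · exact hw

theorem unzip_lt (S : BTree α) (x w : α) (hb : S.IsBST) (hx : x ∉ S.keys)
    (hw : w ∈ S.keys) (hoff : w ∉ searchPath x S) (hwx : w < x) :
    lo w (unzip S x).1 = lo w S ∧ min (x : WithTop α) (hi w (unzip S x).1) = hi w S := by
  induction S with
  | leaf => simp [keys] at hw
  | node l k r ihl ihr =>
    have hx' := hx
    simp only [keys, List.mem_append, List.mem_cons, not_or] at hx'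
    obtain ⟨hxl, hxk, hxr⟩ := hx'
    rcases lt_or_gt_of_ne hxk with h | h
    · have hwk := hwx.trans h
      simp only [searchPath, h, if_true, List.mem_cons, not_or] at hoff
      obtain ⟨h1, h2⟩ := ihl hb.2.2.1 hxl (mem_left hb hw hwk) hoff.2
      simp only [unzip, h.not_gt, if_false]
      rw [lo_left _ _ hwk, hi_left _ _ hwk]
      refine ⟨h1, ?_⟩
      rw [h2, eq_comm, min_eq_right]
      rw [← h2]
      exact (min_le_left _ _).trans (WithTop.coe_le_coe.2 h.le)
    · simp only [searchPath, h, h.not_gt, if_true, if_false, List.mem_cons, not_or] at hoff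
      simp only [unzip, h, if_true]
      rcases lt_or_gt_of_ne hoff.1 with hk | hk
      · rw [lo_left _ _ hk, hi_left _ _ hk, lo_left _ _ hk, hi_left _ _ hk]
        refine ⟨rfl, min_eq_right ?_⟩
        exact (min_le_left _ _).trans (WithTop.coe_le_coe.2 h.le)
      · obtain ⟨h1, h2⟩ := ihr hb.2.2.2 hxr (mem_right hb hw hk) hoff.2
        rw [lo_right _ _ hk, hi_right _ _ hk, lo_right _ _ hk, hi_right _ _ hk, h1]
        exact ⟨rfl, h2⟩

theorem unzip_gt (S : BTree α) (x w : α) (hb : S.IsBST) (hx : x ∉ S.keys)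
    (hw : w ∈ S.keys) (hoff : w ∉ searchPath x S) (hwx : x < w) :
    max (x : WithBot α) (lo w (unzip S x).2) = lo w S ∧ hi w (unzip S x).2 = hi w S := by
  induction S with
  | leaf => simp [keys] at hw
  | node l k r ihl ihr =>
    have hx' := hx
    simp only [keys, List.mem_append, List.mem_cons, not_or] at hx'
    obtain ⟨hxl, hxk, hxr⟩ := hx'
    rcases lt_or_gt_of_ne hxk with h | h
    · simp only [searchPath, h, if_true, List.mem_cons, not_or] at hoff
      simp only [unzip, h.not_gt, if_false]
      rcases lt_or_gt_of_ne hoff.1 with hk | hk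
      · obtain ⟨h1, h2⟩ := ihl hb.2.2.1 hxl (mem_left hb hw hk) hoff.2
        rw [lo_left _ _ hk, hi_left _ _ hk, lo_left _ _ hk, hi_left _ _ hk, h2]
        exact ⟨h1, rfl⟩
      · rw [lo_right _ _ hk, hi_right _ _ hk, lo_right _ _ hk, hi_right _ _ hk]
        refine ⟨max_eq_right ?_, rfl⟩
        exact (WithBot.coe_le_coe.2 h.le).trans (le_max_left _ _)
    · have hwk := h.trans hwx
      simp only [searchPath, h, h.not_gt, if_true, if_false, List.mem_cons, not_or] at hoff
      obtain ⟨h1, h2⟩ := ihr hb.2.2.2 hxr (mem_right hb hw hwk) hoff.2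
      simp only [unzip, h, if_true]
      rw [lo_right _ _ hwk, hi_right _ _ hwk]
      refine ⟨?_, h2⟩
      rw [h1, eq_comm, max_eq_right]
      rw [← h1]
      exact (WithBot.coe_le_coe.2 h.le).trans (le_max_left _ _)

theorem main_aux (T S T' : BTree α) (x : α) (hbst : T.IsBST) (hx : x ∉ T.keys)
    (hins : ZipInsertAt x T S T')
    (w : α) (hw : w ∈ T.keys) (hwoff : w ∉ searchPath x S) :
    lo w T' = lo w T ∧ hi w T' = hi w T := by
  induction hins with
  | here S =>
    have hne : w ≠ x := fun h => hx (h ▸ hw)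
    rcases lt_or_gt_of_ne hne with h | h
    · rw [lo_left _ _ h, hi_left _ _ h]
      exact unzip_lt S x w hbst hx hw hwoff h
    · rw [lo_right _ _ h, hi_right _ _ h]
      exact unzip_gt S x w hbst hx hw hwoff h
  | @left l S l' k r hk _ ih =>
    simp only [keys, List.mem_append, List.mem_cons, not_or] at hx
    rcases lt_trichotomy w k with h | h | h
    · obtain ⟨h1, h2⟩ := ih hbst.2.2.1 hx.1 (mem_left hbst hw h) hwoff
      simp only [lo_left _ _ h, hi_left _ _ h, h1, h2, and_self]
    · subst h
      simp only [lo_self, hi_self, and_self]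
    · simp only [lo_right _ _ h, hi_right _ _ h, and_self]
  | @right l k r S r' hk _ ih =>
    simp only [keys, List.mem_append, List.mem_cons, not_or] at hx
    rcases lt_trichotomy w k with h | h | h
    · simp only [lo_left _ _ h, hi_left _ _ h, and_self]
    · subst h
      simp only [lo_self, hi_self, and_self]
    · obtain ⟨h1, h2⟩ := ih hbst.2.2.2 hx.2.2 (mem_right hbst hw h) hwoff
      simp only [lo_right _ _ h, hi_right _ _ h, h1, h2, and_self]

end BTree

open BTree in
/-- Lemma 4.2 of the paper: after a zip-tree insertion of `x` (replacing a subtree `S`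
on the search path of `x` by `node P x Q` with `(P, Q) = unzip S x`), every key `w` of
the original tree that does not lie on the unzipping path (the search path of `x`
within `S`) keeps the same immediate predecessor ancestor `π_w⁻` and the same
immediate successor ancestor `π_w⁺` (each existing afterwards iff it existed before). -/
theorem zipInsert_preserves_bookends_off_path {α : Type*} [LinearOrder α]
    (T S T' : BTree α) (x : α) (hbst : T.IsBST) (hx : x ∉ T.keys)
    (hins : ZipInsertAt x T S T')
    (w : α) (hw : w ∈ T.keys) (hwoff : w ∉ searchPath x S) :
    ((ancestors w T').filter fun a => a < w).maximum
        = ((ancestors w T).filter fun a => a < w).maximum ∧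
    ((ancestors w T').filter fun a => w < a).minimum
        = ((ancestors w T).filter fun a => w < a).minimum := by
  exact main_aux T S T' x hbst hx hins w hw hwoff
end

section
/- Let T be a binary search tree over a linear order α, let x be a key not occurring in T, and let T' be obtained from T by a zip-tree insertion of x: some subtree S of T whose root lies on the search path of x in T is replaced by node P x Q, where (P, Q) = unzip S x. Then for every key w on the search path of x within S with w < x, the immediate successor ancestor of w in T' is x, while the immediate predecessor ancestor of w is the same in T and T'. Symmetrically, for every key w on that search path with x < w, the immediate predecessor ancestor of w in T' is x, while its immediate successor ancestor is unchanged. -/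
namespace BTree

variable {α : Type*} [LinearOrder α]

theorem mem_keys_of_searchPath (x w : α) (t : BTree α) (h : w ∈ searchPath x t) :
    w ∈ keys t := by
  induction t with
  | leaf => simp [searchPath] at h
  | node l k r ihl ihr =>
    simp only [searchPath] at h
    simp only [keys, List.mem_append, List.mem_cons]
    split_ifs at h <;> simp only [List.mem_cons, List.not_mem_nil] at h <;> tauto

theorem filter_anc_lt (w : α) (t : BTree α) :
    ((ancestors w t).filter fun a => a < w) = (searchPath w t).filter fun a => a < w := by
  simp only [ancestors, List.filter_filter]
  apply List.filter_congr
  intro a _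
  by_cases h : a < w
  · simp [h, h.ne]
  · simp [h]

theorem filter_anc_gt (w : α) (t : BTree α) :
    ((ancestors w t).filter fun a => w < a) = (searchPath w t).filter fun a => w < a := by
  simp only [ancestors, List.filter_filter]
  apply List.filter_congr
  intro a _
  by_cases h : w < a
  · simp [h, h.ne']
  · simp [h]

theorem unzip_left (x w : α) (hwx : w < x) (S : BTree α) (hb : S.IsBST) (hx : x ∉ S.keys)
    (hw : w ∈ searchPath x S) :
    ((searchPath w (unzip S x).1).filter fun a => w < a) = [] ∧
    ((searchPath w (unzip S x).1).filter fun a => a < w)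
      = (searchPath w S).filter fun a => a < w := by
  induction S with
  | leaf => simp [searchPath] at hw
  | node l k r ihl ihr =>
    obtain ⟨h1, h2, h3, h4⟩ := hb
    simp only [keys, List.mem_append, List.mem_cons, not_or] at hx
    obtain ⟨hxl, hxk, hxr⟩ := hx
    rcases lt_or_gt_of_ne hxk with h | h
    · simp only [searchPath, h, if_true, List.mem_cons] at hw
      have hw' : w ∈ searchPath x l := by
        rcases hw with rfl | hw
        · exact absurd hwx h.asymm
        · exact hw
      have hk := hwx.trans h
      simpa [unzip, h.asymm, searchPath, hk, hk.asymm] using ihl h3 hxl hw'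
    · simp only [searchPath, h, h.asymm, if_true, if_false, List.mem_cons] at hw
      rcases hw with rfl | hw
      · simp [unzip, h, searchPath]
      · have hk := h2 w (mem_keys_of_searchPath _ _ _ hw)
        simpa [unzip, h, searchPath, hk, hk.asymm] using ihr h4 hxr hw

theorem unzip_right (x w : α) (hwx : x < w) (S : BTree α) (hb : S.IsBST) (hx : x ∉ S.keys)
    (hw : w ∈ searchPath x S) :
    ((searchPath w (unzip S x).2).filter fun a => a < w) = [] ∧
    ((searchPath w (unzip S x).2).filter fun a => w < a)
      = (searchPath w S).filter fun a => w < a := by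
  induction S with
  | leaf => simp [searchPath] at hw
  | node l k r ihl ihr =>
    obtain ⟨h1, h2, h3, h4⟩ := hb
    simp only [keys, List.mem_append, List.mem_cons, not_or] at hx
    obtain ⟨hxl, hxk, hxr⟩ := hx
    rcases lt_or_gt_of_ne hxk with h | h
    · simp only [searchPath, h, if_true, List.mem_cons] at hw
      rcases hw with rfl | hw
      · simp [unzip, h.asymm, searchPath]
      · have hk := h1 w (mem_keys_of_searchPath _ _ _ hw)
        simpa [unzip, h.asymm, searchPath, hk, hk.asymm] using ihl h3 hxl hw
    · simp only [searchPath, h, h.asymm, if_true, if_false, List.mem_cons] at hw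
      have hw' : w ∈ searchPath x r := by
        rcases hw with rfl | hw
        · exact absurd hwx h.asymm
        · exact hw
      have hk : k < w := lt_trans h hwx
      simpa [unzip, h, searchPath, hk, hk.asymm] using ihr h4 hxr hw'

theorem ZipInsertAt.keys_sub {x : α} {T S T' : BTree α} (h : ZipInsertAt x T S T') :
    ∀ a ∈ keys S, a ∈ keys T := by
  induction h with
  | here S => exact fun a h => h
  | left r _ _ ih => intro a ha; simp [keys, ih a ha]
  | right l _ _ ih => intro a ha; simp [keys, ih a ha]

end BTree

open BTree in
/-- After a zip-tree insertion of `x` (replacing a subtree `S` on the search path of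
`x` by `node P x Q` with `(P, Q) = unzip S x`), every key `w` on the unzipping path
(the search path of `x` within `S`) with `w < x` gets `x` as its new immediate
successor ancestor while its immediate predecessor ancestor is unchanged;
symmetrically, every such `w` with `x < w` gets `x` as its new immediate predecessor
ancestor while its immediate successor ancestor is unchanged. -/
theorem zipInsert_bookends_on_path {α : Type*} [LinearOrder α]
    (T S T' : BTree α) (x : α) (hbst : T.IsBST) (hx : x ∉ T.keys)
    (hins : ZipInsertAt x T S T')
    (w : α) (hwpath : w ∈ searchPath x S) :
    (w < x →
      ((ancestors w T').filter fun a => w < a).minimum = (x : WithTop α) ∧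
      ((ancestors w T').filter fun a => a < w).maximum
          = ((ancestors w T).filter fun a => a < w).maximum) ∧
    (x < w →
      ((ancestors w T').filter fun a => a < w).maximum = (x : WithBot α) ∧
      ((ancestors w T').filter fun a => w < a).minimum
          = ((ancestors w T).filter fun a => w < a).minimum) := by
  simp only [filter_anc_lt, filter_anc_gt]
  induction hins with
  | here S =>
    constructor
    · intro h
      obtain ⟨h1, h2⟩ := unzip_left x w h S hbst hx hwpath
      simp [searchPath, h, h.asymm, h1, h2]
    · intro h
      obtain ⟨h1, h2⟩ := unzip_right x w h S hbst hx hwpath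
      simp [searchPath, h, h.asymm, h1, h2]
  | @left l S l' k r hk hz ih =>
    obtain ⟨b1, b2, b3, b4⟩ := hbst
    have hwk : w < k := b1 w (hz.keys_sub w (mem_keys_of_searchPath _ _ _ hwpath))
    have ih := ih b3 (fun h => hx (by simp [keys, h])) hwpath
    refine ⟨fun h => ?_, fun h => ?_⟩
    · obtain ⟨h1, h2⟩ := ih.1 h
      simp [searchPath, hwk, hwk.asymm, List.minimum_cons, h1, h2, hk.le]
    · obtain ⟨h1, h2⟩ := ih.2 h
      simp [searchPath, hwk, hwk.asymm, List.minimum_cons, h1, h2]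
  | @right l k r S r' hk hz ih =>
    obtain ⟨b1, b2, b3, b4⟩ := hbst
    have hwk : k < w := b2 w (hz.keys_sub w (mem_keys_of_searchPath _ _ _ hwpath))
    have ih := ih b4 (fun h => hx (by simp [keys, h])) hwpath
    refine ⟨fun h => ?_, fun h => ?_⟩
    · obtain ⟨h1, h2⟩ := ih.1 h
      simp [searchPath, hwk, hwk.asymm, List.maximum_cons, h1, h2]
    · obtain ⟨h1, h2⟩ := ih.2 h
      simp [searchPath, hwk, hwk.asymm, List.maximum_cons, h1, h2, hk.le]
end
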